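/- arXiv:1707.08099 — 5 statements merged into one kernel-verified Lean document; each statement's English description precedes it below -/
import Mathlib

section
/- The poset 2+2 (elements a, b, p, q with only strict relations a ≺ b and p ≺ q) admits a {C,D}-representation. Moreover, every {A,B,C,D}-representation (c,τ) of 2+2 satisfies: c(a) = c(p), c(b) = c(q) = c(a) + 1, τ(a) = τ(b), τ(p) = τ(q), and {τ(a), τ(p)} = {C, D}; in particular no element is assigned type A or type B. -/
/-- The four interval types. -/
inductive IType : Type
  | A
  | B
  | C
  | D
  deriving DecidableEq

/-- `typeComp s t` holds iff `s = B`, or `t = B`, or `s = t = C`, or `s = t = D`. -/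
def typeComp : IType → IType → Prop := fun s t =>
  s = IType.B ∨ t = IType.B ∨ (s = IType.C ∧ t = IType.C) ∨ (s = IType.D ∧ t = IType.D)

/-- An `S`-representation of the poset `(X, prec)`: centers `c` and types `τ` with
`τ x ∈ S` for all `x`, such that `prec x y ↔ c x + 1 < c y ∨ (c x + 1 = c y ∧ comp (τ x) (τ y))`. -/
def SRep {X : Type*} (prec : X → X → Prop) (S : Set IType) (c : X → ℝ) (τ : X → IType) : Prop :=
  (∀ x, τ x ∈ S) ∧
    ∀ x y, prec x y ↔ (c x + 1 < c y ∨ (c x + 1 = c y ∧ typeComp (τ x) (τ y)))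

/-- A poset is an `S`-order if it admits an `S`-representation. -/
def SOrder {X : Type*} (prec : X → X → Prop) (S : Set IType) : Prop :=
  ∃ c τ, SRep prec S c τ

/-- Incomparability `x ∥ y`. -/
def Incomp {X : Type*} (prec : X → X → Prop) (x y : X) : Prop :=
  ¬ prec x y ∧ ¬ prec y x

/-- `x 0, x 1, …, x t` is a forcing trail: each step is an up-step or a side-step. -/
def ForcingTrail {X : Type*} (prec : X → X → Prop) (t : ℕ) (x : ℕ → X) : Prop :=
  ∀ i < t, prec (x i) (x (i + 1)) ∨ Incomp prec (x i) (x (i + 1))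

open scoped Classical in
/-- `trailVal prec x i` = number of up-steps minus number of side-steps among the
first `i` steps of the trail `x`. -/
noncomputable def trailVal {X : Type*} (prec : X → X → Prop) (x : ℕ → X) (i : ℕ) : ℤ :=
  ∑ j ∈ Finset.range i, if prec (x j) (x (j + 1)) then 1 else -1

/-- A unit interval order. -/
def UnitIntervalOrder {X : Type*} (prec : X → X → Prop) : Prop :=
  ∃ f : X → ℝ, ∀ x y, prec x y ↔ f x + 1 < f y

/-- Exchange the types `C` and `D`, fixing `A` and `B`. -/
def swapCD : IType → IType
  | IType.C => IType.D
  | IType.D => IType.C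
  | t => t

/-- Two distinct elements are twins if they are incomparable and have the same
comparabilities with every other element. -/
def Twins {X : Type*} (prec : X → X → Prop) (x y : X) : Prop :=
  x ≠ y ∧ Incomp prec x y ∧
    ∀ z, z ≠ x → z ≠ y → ((prec z x ↔ prec z y) ∧ (prec x z ↔ prec y z))

/-- A poset is twin-free if it contains no twins. -/
def TwinFree {X : Type*} (prec : X → X → Prop) : Prop :=
  ∀ x y, ¬ Twins prec x y

/-- A unit OC interval order: unit intervals with left endpoint `g x`, open iff `o x`. -/
def UnitOCOrder {X : Type*} (prec : X → X → Prop) : Prop :=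
  ∃ (g : X → ℝ) (o : X → Bool), ∀ x y,
    prec x y ↔ (g x + 1 < g y ∨ (g x + 1 = g y ∧ (o x = true ∨ o y = true)))

/-- `P` contains an induced copy of `Q`. -/
def ContainsInduced {X : Type*} {Q : Type*} (prec : X → X → Prop) (qrel : Q → Q → Prop) : Prop :=
  ∃ f : Q → X, Function.Injective f ∧ ∀ a b, qrel a b ↔ prec (f a) (f b)

/-- The poset `2+2`: elements `a = 0, b = 1, p = 2, q = 3`; relations `a ≺ b`, `p ≺ q`. -/
def rel2p2 : Fin 4 → Fin 4 → Prop := fun i j =>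
  (i = 0 ∧ j = 1) ∨ (i = 2 ∧ j = 3)

/-- The poset `3+1`: a chain `0 ≺ 1 ≺ 2` plus the isolated element `3`. -/
def rel3p1 : Fin 4 → Fin 4 → Prop := fun i j =>
  (i : ℕ) < (j : ℕ) ∧ (j : ℕ) ≤ 2

/-- The poset `4+1`: a chain `0 ≺ 1 ≺ 2 ≺ 3` plus the isolated element `4`. -/
def rel4p1 : Fin 5 → Fin 5 → Prop := fun i j =>
  (i : ℕ) < (j : ℕ) ∧ (j : ℕ) ≤ 3

/-- The poset `3+1+1`: a chain `0 ≺ 1 ≺ 2` plus isolated elements `3, 4`. -/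
def rel3p1p1 : Fin 5 → Fin 5 → Prop := fun i j =>
  (i : ℕ) < (j : ℕ) ∧ (j : ℕ) ≤ 2

/-- The poset `Z`: `x = 0, y = 1, z = 2, w = 3, u = 4, v = 5` with relations
`x≺y, x≺z, x≺w, y≺z, y≺w, z≺w, x≺v, u≺w`. -/
def relZ : Fin 6 → Fin 6 → Prop := fun i j =>
  ((i : ℕ) < (j : ℕ) ∧ (j : ℕ) ≤ 3) ∨ (i = 0 ∧ j = 5) ∨ (i = 4 ∧ j = 3)

/-- The poset `D`: `x = 0, y = 1, w = 2, z = 3, v = 4` with relations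
`x≺y, x≺w, x≺z, y≺z, w≺z`. -/
def relD : Fin 5 → Fin 5 → Prop := fun i j =>
  (i = 0 ∧ (j = 1 ∨ j = 2 ∨ j = 3)) ∨ ((i = 1 ∨ i = 2) ∧ j = 3)

/-- The poset `Y`: `x = 0, y = 1, z = 2, w = 3, v = 4` with relations
`x≺y, x≺z, x≺w, y≺z, y≺w`. -/
def relY : Fin 5 → Fin 5 → Prop := fun i j =>
  (i = 0 ∧ (j = 1 ∨ j = 2 ∨ j = 3)) ∨ (i = 1 ∧ (j = 2 ∨ j = 3))

/-- The poset `H`: `x = 0, y = 1, z = 2, w = 3, u = 4, v = 5` with relations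
`x≺y, x≺z, x≺w, y≺z, y≺w, z≺w, x≺u, y≺u, v≺z, v≺w`. -/
def relH : Fin 6 → Fin 6 → Prop := fun i j =>
  ((i : ℕ) < (j : ℕ) ∧ (j : ℕ) ≤ 3) ∨ ((i = 0 ∨ i = 1) ∧ j = 4) ∨ (i = 5 ∧ (j = 2 ∨ j = 3))

/-- The poset `V`: `x = 0, b = 1, c = 2, d = 3, e = 4, f = 5` with relations
`x≺b, x≺c, x≺d, x≺e, b≺d, c≺e`. -/
def relV : Fin 6 → Fin 6 → Prop := fun i j =>
  (i = 0 ∧ (j = 1 ∨ j = 2 ∨ j = 3 ∨ j = 4)) ∨ (i = 1 ∧ j = 3) ∨ (i = 2 ∧ j = 4)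

/-- Types that are compatible within each pair but not across the pairs are `C`, `C`, `D`, `D`
or `D`, `D`, `C`, `C`. -/
lemma typeComp_rigid {s t u v : IType} (hst : typeComp s t) (huv : typeComp u v)
    (hsv : ¬ typeComp s v) (hut : ¬ typeComp u t) :
    s = t ∧ u = v ∧ ((s = IType.C ∧ u = IType.D) ∨ (s = IType.D ∧ u = IType.C)) := by
  cases s <;> cases t <;> cases u <;> cases v <;> simp_all [typeComp]

/-- `2+2` (with `a = 0, b = 1, p = 2, q = 3`) admits a `{C,D}`-representation,
and every `{A,B,C,D}`-representation has the stated rigid form. -/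
theorem stmt_14 :
    SOrder rel2p2 {IType.C, IType.D} ∧
    ∀ (c : Fin 4 → ℝ) (τ : Fin 4 → IType), SRep rel2p2 Set.univ c τ →
      (c 0 = c 2 ∧ c 1 = c 0 + 1 ∧ c 3 = c 0 + 1 ∧
        τ 0 = τ 1 ∧ τ 2 = τ 3 ∧
        ({τ 0, τ 2} : Set IType) = {IType.C, IType.D} ∧
        ∀ i, τ i ≠ IType.A ∧ τ i ≠ IType.B) := by
  refine ⟨⟨![0, 1, 0, 1], ![IType.C, IType.C, IType.D, IType.D], ?_, ?_⟩, ?_⟩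
  · intro x
    fin_cases x <;> simp
  · intro x y
    fin_cases x <;> fin_cases y <;> simp [rel2p2, typeComp, Fin.ext_iff]
  · rintro c τ ⟨-, h⟩
    have h01 := (h 0 1).1 (by simp [rel2p2])
    have h23 := (h 2 3).1 (by simp [rel2p2])
    have h03 := mt (h 0 3).2 (by simp [rel2p2])
    have h21 := mt (h 2 1).2 (by simp [rel2p2])
    simp only [not_or, not_lt] at h03 h21
    have le01 : c 0 + 1 ≤ c 1 := h01.elim le_of_lt fun e => e.1.le
    have le23 : c 2 + 1 ≤ c 3 := h23.elim le_of_lt fun e => e.1.le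
    have e02 : c 0 = c 2 := by linarith [h03.1, h21.1]
    have e1 : c 1 = c 0 + 1 := by linarith [h03.1, h21.1]
    have e3 : c 3 = c 0 + 1 := by linarith [h03.1, h21.1]
    obtain ⟨t01, t23, hCD⟩ := typeComp_rigid
      (h01.resolve_left (by linarith)).2 (h23.resolve_left (by linarith)).2
      (fun t => h03.2 ⟨by linarith, t⟩) (fun t => h21.2 ⟨by linarith, t⟩)
    refine ⟨e02, e1, e3, t01, t23, ?_, ?_⟩
    · rcases hCD with ⟨h0, h2⟩ | ⟨h0, h2⟩
      · rw [h0, h2]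
      · rw [h0, h2, Set.pair_comm]
    · intro i
      rcases hCD with ⟨h0, h2⟩ | ⟨h0, h2⟩ <;> fin_cases i <;> simp [h0, h2, ← t01, ← t23]
end

section
/- The poset 3+1 admits an {A,B}-representation, an {A,C}-representation, an {A,D}-representation, and a {C,D}-representation, but it admits no {B,C}-representation and no {B,D}-representation. -/
theorem typeComp_comm {s t : IType} : typeComp s t ↔ typeComp t s := by
  unfold typeComp
  tauto

/-- `3+1` is represented by centers `0, 1, 2` and `1`, with types `s, u, s` on the chain and `v` on
the isolated element, as soon as `s` is compatible with `u` but not with `v`. -/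
theorem sOrder_rel3p1_of_typeComp {S : Set IType} {s u v : IType} (hs : s ∈ S) (hu : u ∈ S)
    (hv : v ∈ S) (hsu : typeComp s u) (hsv : ¬ typeComp s v) : SOrder rel3p1 S := by
  have hus := typeComp_comm.1 hsu
  have hvs := mt typeComp_comm.1 hsv
  refine ⟨![0, 1, 2, 1], ![s, u, s, v], ?_, ?_⟩
  · intro x
    fin_cases x <;> simp [hs, hu, hv]
  · intro x y
    fin_cases x <;> fin_cases y <;> norm_num [rel3p1, hsu, hus, hsv, hvs]

/-- In any representation of `3+1`, the isolated element is centered exactly one unit above the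
bottom of the chain, so their types cannot be compatible. -/
theorem exists_not_typeComp_of_sOrder_rel3p1 {S : Set IType} (h : SOrder rel3p1 S) :
    ∃ s ∈ S, ∃ t ∈ S, ¬ typeComp s t := by
  obtain ⟨c, τ, hτ, h⟩ := h
  refine ⟨τ 0, hτ 0, τ 3, hτ 3, fun hcomp => ?_⟩
  have h01 : c 0 + 1 ≤ c 1 := ((h 0 1).1 (by simp [rel3p1])).elim le_of_lt fun e => e.1.le
  have h12 : c 1 + 1 ≤ c 2 := ((h 1 2).1 (by simp [rel3p1])).elim le_of_lt fun e => e.1.le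
  have h32 : c 2 ≤ c 3 + 1 := by
    by_contra! hlt
    exact absurd ((h 3 2).2 (Or.inl hlt)) (by simp [rel3p1])
  have h03 : c 0 + 1 < c 3 ∨ c 0 + 1 = c 3 ∧ typeComp (τ 0) (τ 3) := by
    rcases lt_or_eq_of_le (show c 0 + 1 ≤ c 3 by linarith) with hlt | heq
    exacts [Or.inl hlt, Or.inr ⟨heq, hcomp⟩]
  exact absurd ((h 0 3).2 h03) (by simp [rel3p1])

/-- `3+1` admits `{A,B}`-, `{A,C}`-, `{A,D}`- and `{C,D}`-representations,
but no `{B,C}`- and no `{B,D}`-representation. -/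
theorem stmt_15 :
    SOrder rel3p1 {IType.A, IType.B} ∧
    SOrder rel3p1 {IType.A, IType.C} ∧
    SOrder rel3p1 {IType.A, IType.D} ∧
    SOrder rel3p1 {IType.C, IType.D} ∧
    ¬ SOrder rel3p1 {IType.B, IType.C} ∧
    ¬ SOrder rel3p1 {IType.B, IType.D} := by
  refine ⟨?_, ?_, ?_, ?_, ?_, ?_⟩
  · exact sOrder_rel3p1_of_typeComp (s := IType.A) (u := IType.B) (v := IType.A)
      (by simp) (by simp) (by simp) (by simp [typeComp]) (by simp [typeComp])
  · exact sOrder_rel3p1_of_typeComp (s := IType.C) (u := IType.C) (v := IType.A)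
      (by simp) (by simp) (by simp) (by simp [typeComp]) (by simp [typeComp])
  · exact sOrder_rel3p1_of_typeComp (s := IType.D) (u := IType.D) (v := IType.A)
      (by simp) (by simp) (by simp) (by simp [typeComp]) (by simp [typeComp])
  · exact sOrder_rel3p1_of_typeComp (s := IType.C) (u := IType.C) (v := IType.D)
      (by simp) (by simp) (by simp) (by simp [typeComp]) (by simp [typeComp])
  all_goals
    intro h
    obtain ⟨s, hs, t, ht, hst⟩ := exists_not_typeComp_of_sOrder_rel3p1 h
    rcases hs with rfl | rfl <;> rcases ht with rfl | rfl <;> simp [typeComp] at hst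
end

section
/- The poset 4+1 admits no {A,B,C,D}-representation; hence it is not an S-order for any subset S of {A,B,C,D}. -/
/-- Comparable elements have centers at distance at least one. -/
theorem SRep.add_one_le {X : Type*} {prec : X → X → Prop} {S : Set IType} {c : X → ℝ}
    {τ : X → IType} (h : SRep prec S c τ) {x y : X} (hxy : prec x y) : c x + 1 ≤ c y := by
  rcases (h.2 x y).1 hxy with h | h
  · exact h.le
  · exact h.1.le

/-- If `x` does not precede `y`, the center of `y` is at most one above that of `x`. -/
theorem SRep.le_add_one {X : Type*} {prec : X → X → Prop} {S : Set IType} {c : X → ℝ}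
    {τ : X → IType} (h : SRep prec S c τ) {x y : X} (hxy : ¬ prec x y) : c y ≤ c x + 1 :=
  not_lt.1 fun hlt => hxy ((h.2 x y).2 (Or.inl hlt))

theorem not_sOrder_rel4p1 (S : Set IType) : ¬ SOrder rel4p1 S := by
  rintro ⟨c, τ, h⟩
  have h01 := h.add_one_le (x := 0) (y := 1) (by simp [rel4p1])
  have h12 := h.add_one_le (x := 1) (y := 2) (by simp [rel4p1])
  have h23 := h.add_one_le (x := 2) (y := 3) (by simp [rel4p1])
  have h04 := h.le_add_one (x := 0) (y := 4) (by simp [rel4p1])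
  have h43 := h.le_add_one (x := 4) (y := 3) (by simp [rel4p1])
  linarith

/-- `4+1` admits no `{A,B,C,D}`-representation, hence is not an `S`-order
for any `S`. -/
theorem stmt_16 :
    (¬ SOrder rel4p1 Set.univ) ∧ ∀ S : Set IType, ¬ SOrder rel4p1 S :=
  ⟨not_sOrder_rel4p1 _, not_sOrder_rel4p1⟩
end

section
/- Every nontrivial forcing cycle in the poset V has value at most 0, yet V admits no {A,B,C,D}-representation; hence V is not an S-order for any subset S of {A,B,C,D}. -/
instance : DecidableRel relV := fun i j => by
  unfold relV
  infer_instance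

/-- If a potential `φ` rises by at least one along each relation and drops by at most one between
incomparable elements, then it bounds the value of every forcing trail. -/
theorem ForcingTrail.trailVal_le {X : Type*} {prec : X → X → Prop} {t : ℕ} {x : ℕ → X}
    (hx : ForcingTrail prec t x) (φ : X → ℤ) (hup : ∀ a b, prec a b → φ a + 1 ≤ φ b)
    (hside : ∀ a b, Incomp prec a b → φ a - 1 ≤ φ b) :
    trailVal prec x t ≤ φ (x t) - φ (x 0) := by
  induction t with
  | zero => simp [trailVal]
  | succ n ih =>
    have h := ih fun i hi => hx i (hi.trans n.lt_succ_self)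
    have hstep := hx n n.lt_succ_self
    unfold trailVal at h ⊢
    rw [Finset.sum_range_succ]
    split_ifs with hn
    · linarith [hup _ _ hn]
    · linarith [hside _ _ (hstep.resolve_left hn)]

namespace SRep

variable {X : Type*} {prec : X → X → Prop} {S : Set IType} {c : X → ℝ} {τ : X → IType} {x y : X}

theorem add_one_le_s17 (h : SRep prec S c τ) (hxy : prec x y) : c x + 1 ≤ c y := by
  rcases (h.2 x y).1 hxy with hlt | ⟨heq, -⟩
  exacts [hlt.le, heq.le]

theorem le_add_one_s17 (h : SRep prec S c τ) (hxy : ¬ prec x y) : c y ≤ c x + 1 :=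
  not_lt.1 fun hlt => hxy ((h.2 x y).2 (Or.inl hlt))

theorem prec_iff_typeComp (h : SRep prec S c τ) (hxy : c x + 1 = c y) :
    prec x y ↔ typeComp (τ x) (τ y) := by
  simp [h.2 x y, hxy]

end SRep

theorem not_sOrder_relV (S : Set IType) : ¬ SOrder relV S := by
  rintro ⟨c, τ, h⟩
  have hxb := h.add_one_le_s17 (x := 0) (y := 1) (by decide)
  have hxc := h.add_one_le_s17 (x := 0) (y := 2) (by decide)
  have hbd := h.add_one_le_s17 (x := 1) (y := 3) (by decide)
  have hce := h.add_one_le_s17 (x := 2) (y := 4) (by decide)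
  have hxf := h.le_add_one_s17 (x := 0) (y := 5) (by decide)
  have hfd := h.le_add_one_s17 (x := 5) (y := 3) (by decide)
  have hfe := h.le_add_one_s17 (x := 5) (y := 4) (by decide)
  have txb := (h.prec_iff_typeComp (x := 0) (y := 1) (by linarith)).1 (by decide)
  have txc := (h.prec_iff_typeComp (x := 0) (y := 2) (by linarith)).1 (by decide)
  have tbd := (h.prec_iff_typeComp (x := 1) (y := 3) (by linarith)).1 (by decide)
  have tce := (h.prec_iff_typeComp (x := 2) (y := 4) (by linarith)).1 (by decide)
  have txf := (h.prec_iff_typeComp (x := 0) (y := 5) (by linarith)).not.1 (by decide)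
  have tbe := (h.prec_iff_typeComp (x := 1) (y := 4) (by linarith)).not.1 (by decide)
  have tcd := (h.prec_iff_typeComp (x := 2) (y := 3) (by linarith)).not.1 (by decide)
  unfold typeComp at *
  grind

/-- every nontrivial forcing cycle in `V` has value at most `0`, yet `V`
admits no `{A,B,C,D}`-representation, hence is not an `S`-order for any `S`. -/
theorem stmt_17 :
    (∀ (t : ℕ) (x : ℕ → Fin 6), 1 ≤ t → ForcingTrail relV t x → x t = x 0 →
      trailVal relV x t ≤ 0) ∧
    (¬ SOrder relV Set.univ) ∧
    ∀ S : Set IType, ¬ SOrder relV S := by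
  refine ⟨fun t x _ hx hcycle => ?_, not_sOrder_relV _, not_sOrder_relV⟩
  have h := hx.trailVal_le ![0, 1, 1, 2, 2, 1] (by decide)
    (by unfold Incomp; decide)
  simpa [hcycle] using h
end

section
/- The poset Z admits an {A,C}-representation and an {A,D}-representation, but admits no {C,D}-representation. Moreover, in every {A,B,C,D}-representation of Z, no element is assigned type B. -/
/-- In every representation of `Z` the centers are forced up to translation, so that the
comparabilities between consecutive levels are determined by the types. -/
theorem SRep.relZ_typeComp {S : Set IType} {c : Fin 6 → ℝ} {τ : Fin 6 → IType}
    (h : SRep relZ S c τ) :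
    (typeComp (τ 0) (τ 1) ∧ typeComp (τ 1) (τ 2) ∧ typeComp (τ 2) (τ 3)) ∧
      ¬ typeComp (τ 0) (τ 4) ∧ ¬ typeComp (τ 4) (τ 2) ∧ ¬ typeComp (τ 4) (τ 5) ∧
      ¬ typeComp (τ 1) (τ 5) ∧ ¬ typeComp (τ 5) (τ 3) := by
  have le_of_prec : ∀ i j, relZ i j → c i + 1 ≤ c j := fun i j hij =>
    ((h.2 i j).1 hij).elim le_of_lt fun e => e.1.le
  have le_of_not_prec : ∀ i j, ¬ relZ i j → c j ≤ c i + 1 := fun i j hij =>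
    not_lt.1 fun hlt => hij ((h.2 i j).2 (Or.inl hlt))
  have comp_of_prec : ∀ i j, relZ i j → c i + 1 = c j → typeComp (τ i) (τ j) :=
    fun i j hij e => ((h.2 i j).1 hij).elim (fun hlt => absurd e hlt.ne) And.right
  have not_comp : ∀ i j, ¬ relZ i j → c i + 1 = c j → ¬ typeComp (τ i) (τ j) :=
    fun i j hij e ht => hij ((h.2 i j).2 (Or.inr ⟨e, ht⟩))
  have h01 : relZ 0 1 := by simp [relZ]
  have h12 : relZ 1 2 := by simp [relZ]
  have h23 : relZ 2 3 := by simp [relZ]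
  have h04 : ¬ relZ 0 4 := by simp [relZ]
  have h42 : ¬ relZ 4 2 := by simp [relZ]
  have h45 : ¬ relZ 4 5 := by simp [relZ]
  have h15 : ¬ relZ 1 5 := by simp [relZ]
  have h53 : ¬ relZ 5 3 := by simp [relZ]
  have c01 := le_of_prec 0 1 h01
  have c12 := le_of_prec 1 2 h12
  have c23 := le_of_prec 2 3 h23
  have c04 := le_of_not_prec 0 4 h04
  have c42 := le_of_not_prec 4 2 h42
  have c15 := le_of_not_prec 1 5 h15
  have c53 := le_of_not_prec 5 3 h53
  exact ⟨⟨comp_of_prec 0 1 h01 (by linarith), comp_of_prec 1 2 h12 (by linarith),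
      comp_of_prec 2 3 h23 (by linarith)⟩,
    not_comp 0 4 h04 (by linarith), not_comp 4 2 h42 (by linarith),
    not_comp 4 5 h45 (by linarith), not_comp 1 5 h15 (by linarith),
    not_comp 5 3 h53 (by linarith)⟩

/-- `Z` is represented by giving its chain a type `T ∈ {C, D}` and its other elements type `A`. -/
theorem sOrder_relZ {T : IType} (hT : T = IType.C ∨ T = IType.D) :
    SOrder relZ {IType.A, T} := by
  refine ⟨![0, 1, 2, 3, 1, 2], ![T, T, T, T, IType.A, IType.A], ?_, ?_⟩
  · intro i
    fin_cases i <;> simp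
  · intro i j
    rcases hT with rfl | rfl <;> fin_cases i <;> fin_cases j <;>
      simp [relZ, typeComp] <;> norm_num

/-- `Z` admits `{A,C}`- and `{A,D}`-representations but no
`{C,D}`-representation, and no `{A,B,C,D}`-representation of `Z` uses type `B`. -/
theorem stmt_18 :
    SOrder relZ {IType.A, IType.C} ∧
    SOrder relZ {IType.A, IType.D} ∧
    ¬ SOrder relZ {IType.C, IType.D} ∧
    ∀ (c : Fin 6 → ℝ) (τ : Fin 6 → IType), SRep relZ Set.univ c τ →
      ∀ i, τ i ≠ IType.B := by
  refine ⟨sOrder_relZ (Or.inl rfl), sOrder_relZ (Or.inr rfl), ?_, ?_⟩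
  · rintro ⟨c, τ, h⟩
    have hCD : ∀ i, τ i = IType.C ∨ τ i = IType.D := h.1
    obtain ⟨⟨-, h12, -⟩, -, h42, h45, h15, -⟩ := h.relZ_typeComp
    have h1 := hCD 1
    have h2 := hCD 2
    have h4 := hCD 4
    have h5 := hCD 5
    unfold typeComp at *
    grind
  · intro c τ h i hi
    obtain ⟨-, h04, h42, h45, h15, h53⟩ := h.relZ_typeComp
    unfold typeComp at *
    fin_cases i <;> simp_all
end
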